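/- arXiv:2011.01916 — 4 statements merged into one kernel-verified Lean document; each statement's English description precedes it below -/
import Mathlib

section
/- Let M be a left-cancellative monoid (a·x = a·y implies x = y) equipped with a function ℓ : M → ℕ such that ℓ(xy) = ℓ(x) + ℓ(y), ℓ(x) = 0 if and only if x = 1, each set {x ∈ M : ℓ(x) = n} is finite, and M is generated as a monoid by {x ∈ M : ℓ(x) = 1}. Define x ≤ y iff y = xz for some z ∈ M. Then ≤ is a partial order on M; with rank function ℓ, M is a ranked poset of finite type; and for every a ∈ M the map x ↦ a·x is an order isomorphism from M onto the principal order filter {y ∈ M : y ≥ a}. In particular, M with this order is an upho poset. -/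
/-- A poset `P` with rank function `ρ` is ranked: minimal elements have rank `0`,
and ranks increase by one along cover relations. -/
def IsRanked {P : Type*} [PartialOrder P] (ρ : P → ℕ) : Prop :=
  (∀ x : P, (∀ y : P, ¬ y < x) → ρ x = 0) ∧ ∀ x y : P, x ⋖ y → ρ y = ρ x + 1

/-- A ranked poset is of finite type if each rank level is finite. -/
def IsFiniteType {P : Type*} [PartialOrder P] (ρ : P → ℕ) : Prop :=
  ∀ n : ℕ, {x : P | ρ x = n}.Finite

/-- A ranked poset of finite type is upho if every principal order filter,
with the induced order, is order-isomorphic to the whole poset. -/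
def IsUpho (P : Type*) [PartialOrder P] (ρ : P → ℕ) : Prop :=
  IsRanked ρ ∧ IsFiniteType ρ ∧ ∀ s : P, Nonempty ({t : P // s ≤ t} ≃o P)

/-- In a monoid generated by a set `S`, every element other than `1` has a left factor in `S`. -/
theorem Submonoid.eq_one_or_exists_mul_of_closure_eq_top {M : Type*} [Monoid M] {S : Set M}
    (hS : Submonoid.closure S = ⊤) (z : M) : z = 1 ∨ ∃ g ∈ S, ∃ w, z = g * w := by
  have hz : z ∈ Submonoid.closure S := hS ▸ Submonoid.mem_top z
  induction hz using Submonoid.closure_induction with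
  | mem x hx => exact Or.inr ⟨x, hx, 1, (mul_one x).symm⟩
  | one => exact Or.inl rfl
  | mul x y _ _ ihx ihy =>
    rcases ihx with rfl | ⟨g, hg, w, rfl⟩
    · simpa only [one_mul] using ihy
    · exact Or.inr ⟨g, hg, w * y, mul_assoc g w y⟩

/-- Left divisibility as a partial order on a monoid with an additive length function that
vanishes only at `1`. -/
abbrev leftDivisibilityOrder {M : Type*} [Monoid M] (ℓ : M → ℕ)
    (hadd : ∀ x y : M, ℓ (x * y) = ℓ x + ℓ y) (hzero : ∀ x : M, ℓ x = 0 ↔ x = 1) :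
    PartialOrder M where
  le x y := ∃ z : M, y = x * z
  le_refl x := ⟨1, (mul_one x).symm⟩
  le_trans := by
    rintro x _ _ ⟨z, rfl⟩ ⟨w, rfl⟩
    exact ⟨z * w, mul_assoc x z w⟩
  le_antisymm := by
    rintro x _ ⟨z, rfl⟩ ⟨w, hw⟩
    have h := congrArg ℓ hw
    rw [hadd, hadd] at h
    have hz : z = 1 := (hzero z).1 (by omega)
    rw [hz, mul_one]

/-- Let `M` be a left-cancellative monoid equipped with a length function `ℓ` that is
additive, vanishes exactly at the identity, has finite levels, and whose level-`1`
elements generate `M`. Then left divisibility (`x ≤ y` iff `y = x·z` for some `z`) is a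
partial order on `M`; with rank function `ℓ`, `M` is a ranked poset of finite type; and
for every `a ∈ M` the map `x ↦ a·x` is an order isomorphism from `M` onto the principal
order filter `{y : y ≥ a}` (it lands in the filter, is surjective onto it, and preserves
and reflects the order). In particular, `M` with this order is an upho poset. -/
theorem monoid_left_divisibility_upho (M : Type*) [Monoid M] (ℓ : M → ℕ)
    (hcancel : ∀ a x y : M, a * x = a * y → x = y)
    (hadd : ∀ x y : M, ℓ (x * y) = ℓ x + ℓ y)
    (hzero : ∀ x : M, ℓ x = 0 ↔ x = 1)
    (hfin : ∀ n : ℕ, {x : M | ℓ x = n}.Finite)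
    (hgen : Submonoid.closure {x : M | ℓ x = 1} = ⊤) :
    ∃ inst : PartialOrder M,
      (∀ x y : M, inst.le x y ↔ ∃ z : M, y = x * z) ∧
      @IsUpho M inst ℓ ∧
      ∀ a : M,
        (∀ x : M, inst.le a (a * x)) ∧
        (∀ y : M, inst.le a y → ∃ x : M, y = a * x) ∧
        (∀ x y : M, inst.le x y ↔ inst.le (a * x) (a * y)) := by
  let inst : PartialOrder M := leftDivisibilityOrder ℓ hadd hzero
  have le_iff (x y : M) : x ≤ y ↔ ∃ z : M, y = x * z := Iff.rfl
  have le_mul (x z : M) : x ≤ x * z := ⟨z, rfl⟩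
  have mul_le_mul_iff (a x y : M) : x ≤ y ↔ a * x ≤ a * y := by
    simp only [le_iff, mul_assoc]
    exact exists_congr fun z => ⟨congrArg (a * ·), hcancel a y (x * z)⟩
  have lt_mul (x z : M) (hz : ℓ z ≠ 0) : x < x * z := by
    refine lt_of_le_of_ne (le_mul x z) fun h => hz ?_
    have h' := congrArg ℓ h
    rw [hadd] at h'
    omega
  refine ⟨inst, le_iff, ⟨⟨fun x hx => ?_, fun x y hxy => ?_⟩, hfin, fun s => ?_⟩,
    fun a => ⟨le_mul a, fun _ h => h, mul_le_mul_iff a⟩⟩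
  · by_contra h
    exact hx 1 (by simpa only [one_mul] using lt_mul 1 x h)
  · obtain ⟨z, rfl⟩ := hxy.le
    rcases Submonoid.eq_one_or_exists_mul_of_closure_eq_top hgen z with rfl | ⟨g, hg, w, rfl⟩
    · exact absurd hxy.lt (by simp only [mul_one, lt_irrefl, not_false_eq_true])
    · have hg : ℓ g = 1 := hg
      have hw : ℓ w = 0 := by
        by_contra hw
        exact hxy.2 (lt_mul x g (by omega)) (by simpa only [mul_assoc] using lt_mul (x * g) w hw)
      rw [hadd, hadd, hg, hw]
  · let f : M ↪o {t : M // s ≤ t} :=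
      OrderEmbedding.ofMapLEIff (fun x => ⟨s * x, le_mul s x⟩)
        fun x y => (mul_le_mul_iff s x y).symm
    refine ⟨(RelIso.ofSurjective f ?_).symm⟩
    rintro ⟨_, x, rfl⟩
    exact ⟨x, rfl⟩
end

section
/- For every subset T ⊆ {2, 3, 4, …}, the quotient monoid M_T = {L,R}*/~_T is left-cancellative: for all words A, X, Y over {L,R}, if AX ~_T AY then X ~_T Y. -/
/-- The letter `L`, as a one-letter word in the free monoid on the two letters
`{L, R}` (encoded as `Bool`, with `L = false` and `R = true`). -/
def Lw : FreeMonoid Bool := FreeMonoid.of false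

/-- The letter `R`, as a one-letter word in the free monoid on `{L, R}`. -/
def Rw : FreeMonoid Bool := FreeMonoid.of true

/-- The word `w_n = (LR)^n LL`. -/
def wWord (n : ℕ) : FreeMonoid Bool := (Lw * Rw) ^ n * (Lw * Lw)

/-- The word `v_n = RR L^(2n−2) RL`. -/
def vWord (n : ℕ) : FreeMonoid Bool := Rw * Rw * Lw ^ (2 * n - 2) * (Rw * Lw)

/-- The generating relation identifying `w_n` with `v_n` for all `n ∈ T`. -/
def sternRel (T : Set ℕ) : FreeMonoid Bool → FreeMonoid Bool → Prop :=
  fun u v => ∃ n ∈ T, u = wWord n ∧ v = vWord n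

/-- `~_T`: the smallest monoid congruence on `{L,R}*` containing the pairs
`(w_n, v_n)` for all `n ∈ T`. -/
def sternCon (T : Set ℕ) : Con (FreeMonoid Bool) := conGen (sternRel T)

theorem Lw_mul_ne_Rw_mul (x y : FreeMonoid Bool) : Lw * x ≠ Rw * y := by
  intro h
  have := congrArg FreeMonoid.toList h
  simp [Lw, Rw] at this

theorem Lw_mul_injective : Function.Injective (Lw * · : FreeMonoid Bool → FreeMonoid Bool) :=
  fun x y h => by
    have := congrArg FreeMonoid.toList h
    simpa [Lw] using this

theorem Rw_mul_injective : Function.Injective (Rw * · : FreeMonoid Bool → FreeMonoid Bool) :=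
  fun x y h => by
    have := congrArg FreeMonoid.toList h
    simpa [Rw] using this

/-- In a word `L^a R x`, the exponent `a` and the remainder `x` are determined. -/
theorem Lw_pow_mul_Rw_mul_inj {a b : ℕ} {x y : FreeMonoid Bool}
    (h : Lw ^ a * (Rw * x) = Lw ^ b * (Rw * y)) : a = b ∧ x = y := by
  induction a generalizing b with
  | zero =>
    cases b with
    | zero => exact ⟨rfl, Rw_mul_injective (by simpa using h)⟩
    | succ b =>
      rw [pow_succ', mul_assoc, pow_zero, one_mul] at h
      exact absurd h.symm (Lw_mul_ne_Rw_mul _ _)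
  | succ a ih =>
    cases b with
    | zero =>
      rw [pow_succ', mul_assoc, pow_zero, one_mul] at h
      exact absurd h (Lw_mul_ne_Rw_mul _ _)
    | succ b =>
      rw [pow_succ', pow_succ', mul_assoc, mul_assoc] at h
      obtain ⟨rfl, rfl⟩ := ih (Lw_mul_injective h)
      exact ⟨rfl, rfl⟩

/-- The words `w_n` form a prefix code. -/
theorem wWord_mul_inj {n m : ℕ} {x y : FreeMonoid Bool}
    (h : wWord n * x = wWord m * y) : n = m ∧ x = y := by
  unfold wWord at h
  induction n generalizing m with
  | zero =>
    cases m with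
    | zero =>
      simp only [pow_zero, one_mul, mul_assoc] at h
      exact ⟨rfl, Lw_mul_injective (Lw_mul_injective h)⟩
    | succ m =>
      simp only [pow_succ', pow_zero, one_mul, mul_assoc] at h
      exact absurd (Lw_mul_injective h) (Lw_mul_ne_Rw_mul _ _)
  | succ n ih =>
    cases m with
    | zero =>
      simp only [pow_succ', pow_zero, one_mul, mul_assoc] at h
      exact absurd (Lw_mul_injective h).symm (Lw_mul_ne_Rw_mul _ _)
    | succ m =>
      simp only [pow_succ', mul_assoc] at h ih
      obtain ⟨rfl, rfl⟩ := ih (Rw_mul_injective (Lw_mul_injective h))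
      exact ⟨rfl, rfl⟩

/-- The word `R L^(2n−2) RL`, that is, `v_n` with its first letter removed. -/
def vTail (n : ℕ) : FreeMonoid Bool := Rw * Lw ^ (2 * n - 2) * (Rw * Lw)

theorem vWord_eq_Rw_mul_vTail (n : ℕ) : vWord n = Rw * vTail n := by
  simp only [vWord, vTail, mul_assoc]

theorem vTail_mul_inj {n m : ℕ} (hn : 2 ≤ n) (hm : 2 ≤ m) {x y : FreeMonoid Bool}
    (h : vTail n * x = vTail m * y) : n = m ∧ x = y := by
  simp only [vTail, mul_assoc] at h
  obtain ⟨hnm, hxy⟩ := Lw_pow_mul_Rw_mul_inj (Rw_mul_injective h)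
  exact ⟨by omega, Lw_mul_injective hxy⟩

theorem wWord_mul_ne_Rw_mul {n : ℕ} (hn : 2 ≤ n) (x y : FreeMonoid Bool) :
    wWord n * x ≠ Rw * y := by
  obtain ⟨k, rfl⟩ := Nat.exists_eq_add_of_le' hn
  simp only [wWord, pow_succ', mul_assoc]
  exact Lw_mul_ne_Rw_mul _ _

open Classical in
/-- Left multiplication by `R` followed by the rewriting `v_n → w_n` (for `n ∈ T`) at the
beginning of the resulting word, when it applies. -/
noncomputable def reduceR (T : Set ℕ) (x : FreeMonoid Bool) : FreeMonoid Bool :=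
  if h : ∃ p : ℕ × FreeMonoid Bool, p.1 ∈ T ∧ x = vTail p.1 * p.2 then
    wWord h.choose.1 * h.choose.2
  else Rw * x

section

variable {T : Set ℕ}

theorem reduceR_vTail_mul (hT : ∀ n ∈ T, 2 ≤ n) {n : ℕ} (hn : n ∈ T) (z : FreeMonoid Bool) :
    reduceR T (vTail n * z) = wWord n * z := by
  have h : ∃ p : ℕ × FreeMonoid Bool, p.1 ∈ T ∧ vTail n * z = vTail p.1 * p.2 :=
    ⟨(n, z), hn, rfl⟩
  obtain ⟨hmem, heq⟩ := h.choose_spec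
  obtain ⟨h₁, h₂⟩ := vTail_mul_inj (hT _ hn) (hT _ hmem) heq
  rw [reduceR, dif_pos h, ← h₁, ← h₂]

theorem reduceR_of_forall_ne {x : FreeMonoid Bool} (h : ∀ n ∈ T, ∀ z, x ≠ vTail n * z) :
    reduceR T x = Rw * x :=
  dif_neg fun ⟨p, hp, hx⟩ => h p.1 hp p.2 hx

theorem reduceR_Lw_mul (x : FreeMonoid Bool) : reduceR T (Lw * x) = Rw * (Lw * x) :=
  reduceR_of_forall_ne fun n _ z h => by
    simp only [vTail, mul_assoc] at h
    exact Lw_mul_ne_Rw_mul _ _ h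

theorem reduceR_Rw_mul_Lw_pow_mul (hT : ∀ n ∈ T, 2 ≤ n) {n : ℕ} (hn : n ∈ T)
    (z : FreeMonoid Bool) :
    reduceR T (reduceR T (Lw ^ (2 * n - 2) * (Rw * (Lw * z)))) = wWord n * z := by
  have hpow : Lw ^ (2 * n - 2) = Lw * Lw ^ (2 * n - 3) := by
    have := hT n hn
    rw [← pow_succ']
    congr 1
    omega
  have hinner : reduceR T (Lw ^ (2 * n - 2) * (Rw * (Lw * z))) = vTail n * z := by
    rw [hpow, mul_assoc, reduceR_Lw_mul, vTail, hpow]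
    simp only [mul_assoc]
  rw [hinner, reduceR_vTail_mul hT hn]

theorem exists_vTail_or_reduceR_eq (hT : ∀ n ∈ T, 2 ≤ n) (x : FreeMonoid Bool) :
    (∃ n ∈ T, ∃ z, x = vTail n * z ∧ reduceR T x = wWord n * z) ∨ reduceR T x = Rw * x := by
  by_cases h : ∃ n ∈ T, ∃ z, x = vTail n * z
  · obtain ⟨n, hn, z, rfl⟩ := h
    exact Or.inl ⟨n, hn, z, rfl, reduceR_vTail_mul hT hn z⟩
  · exact Or.inr (reduceR_of_forall_ne fun n hn z hx => h ⟨n, hn, z, hx⟩)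

theorem reduceR_injective (hT : ∀ n ∈ T, 2 ≤ n) : Function.Injective (reduceR T) := by
  intro x y h
  rcases exists_vTail_or_reduceR_eq hT x with ⟨n, hn, z, hx, hxr⟩ | hxr <;>
    rcases exists_vTail_or_reduceR_eq hT y with ⟨m, hm, z', hy, hyr⟩ | hyr <;>
    rw [hxr, hyr] at h
  · obtain ⟨rfl, rfl⟩ := wWord_mul_inj h
    rw [hx, hy]
  · exact absurd h (wWord_mul_ne_Rw_mul (hT n hn) _ _)
  · exact absurd h.symm (wWord_mul_ne_Rw_mul (hT m hm) _ _)
  · exact Rw_mul_injective h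

theorem sternCon_reduceR (hT : ∀ n ∈ T, 2 ≤ n) (x : FreeMonoid Bool) :
    sternCon T (Rw * x) (reduceR T x) := by
  rcases exists_vTail_or_reduceR_eq hT x with ⟨n, hn, z, rfl, hr⟩ | hr <;> rw [hr]
  · rw [← mul_assoc, ← vWord_eq_Rw_mul_vTail]
    exact (sternCon T).mul
      ((sternCon T).symm (ConGen.Rel.of _ _ ⟨n, hn, rfl, rfl⟩)) ((sternCon T).refl z)
  · exact (sternCon T).refl _

end

/-- The action of `{L,R}*` on words in which `L` acts by left multiplication and `R` acts by
`reduceR T`. -/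
noncomputable def reduceAction (T : Set ℕ) : FreeMonoid Bool →* Function.End (FreeMonoid Bool) :=
  FreeMonoid.lift fun b => if b then reduceR T else (Lw * ·)

section

variable {T : Set ℕ}

theorem reduceAction_mul (x y z : FreeMonoid Bool) :
    reduceAction T (x * y) z = reduceAction T x (reduceAction T y z) := by
  rw [map_mul]
  rfl

theorem reduceAction_Lw (x : FreeMonoid Bool) : reduceAction T Lw x = Lw * x := by
  simp [reduceAction, Lw]

theorem reduceAction_Rw (x : FreeMonoid Bool) : reduceAction T Rw x = reduceR T x := by
  simp [reduceAction, Rw]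

theorem reduceAction_Lw_pow (k : ℕ) (x : FreeMonoid Bool) :
    reduceAction T (Lw ^ k) x = Lw ^ k * x := by
  induction k with
  | zero => rw [pow_zero, map_one, one_mul]; rfl
  | succ k ih => rw [pow_succ', reduceAction_mul, ih, reduceAction_Lw, mul_assoc]

theorem reduceAction_wWord (n : ℕ) (x : FreeMonoid Bool) :
    reduceAction T (wWord n) x = wWord n * x := by
  suffices h : ∃ y, reduceAction T (wWord n) x = wWord n * x ∧ wWord n * x = Lw * y by
    exact h.choose_spec.1
  induction n with
  | zero =>
    refine ⟨Lw * x, ?_, ?_⟩ <;>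
      simp only [wWord, pow_zero, one_mul, reduceAction_mul, reduceAction_Lw, mul_assoc]
  | succ n ih =>
    obtain ⟨y, hy, hy'⟩ := ih
    have hsucc : wWord (n + 1) = Lw * (Rw * wWord n) := by
      simp only [wWord, pow_succ', mul_assoc]
    refine ⟨Rw * (wWord n * x), ?_, ?_⟩
    · rw [hsucc, reduceAction_mul, reduceAction_mul, hy, hy', reduceAction_Rw, reduceR_Lw_mul,
        reduceAction_Lw, ← hy']
      simp only [mul_assoc]
    · rw [hsucc]
      simp only [mul_assoc]

theorem reduceAction_vWord (hT : ∀ n ∈ T, 2 ≤ n) {n : ℕ} (hn : n ∈ T) (x : FreeMonoid Bool) :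
    reduceAction T (vWord n) x = wWord n * x := by
  simp only [vWord, reduceAction_mul, reduceAction_Lw, reduceAction_Rw, reduceAction_Lw_pow,
    reduceR_Lw_mul]
  exact reduceR_Rw_mul_Lw_pow_mul hT hn x

theorem reduceAction_eq_of_sternCon (hT : ∀ n ∈ T, 2 ≤ n) {x y : FreeMonoid Bool}
    (h : sternCon T x y) : reduceAction T x = reduceAction T y := by
  have hle : sternCon T ≤ Con.ker (reduceAction T) := by
    refine Con.conGen_le.2 ?_
    rintro u v ⟨n, hn, rfl, rfl⟩
    refine (Con.ker_rel _).2 (funext fun z => ?_)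
    rw [reduceAction_wWord, reduceAction_vWord hT hn]
  exact (Con.ker_rel _).1 (hle h)

theorem reduceAction_injective (hT : ∀ n ∈ T, 2 ≤ n) (x : FreeMonoid Bool) :
    Function.Injective (reduceAction T x) := by
  induction x using FreeMonoid.inductionOn' with
  | one => rw [map_one]; exact Function.injective_id
  | of_mul b x ih =>
    intro y z h
    rw [reduceAction_mul, reduceAction_mul] at h
    cases b with
    | false =>
      change reduceAction T Lw _ = reduceAction T Lw _ at h
      rw [reduceAction_Lw, reduceAction_Lw] at h
      exact ih (Lw_mul_injective h)
    | true =>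
      change reduceAction T Rw _ = reduceAction T Rw _ at h
      rw [reduceAction_Rw, reduceAction_Rw] at h
      exact ih (reduceR_injective hT h)

theorem sternCon_reduceAction (hT : ∀ n ∈ T, 2 ≤ n) (x : FreeMonoid Bool) :
    sternCon T x (reduceAction T x 1) := by
  induction x using FreeMonoid.inductionOn' with
  | one => exact (sternCon T).refl 1
  | of_mul b x ih =>
    rw [reduceAction_mul]
    refine (sternCon T).trans ((sternCon T).mul ((sternCon T).refl _) ih) ?_
    cases b with
    | false =>
      change sternCon T (Lw * _) (reduceAction T Lw _)
      rw [reduceAction_Lw]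
      exact (sternCon T).refl _
    | true =>
      change sternCon T (Rw * _) (reduceAction T Rw _)
      rw [reduceAction_Rw]
      exact sternCon_reduceR hT _

end

/-- For every subset `T ⊆ {2, 3, 4, …}`, the quotient monoid `M_T = {L,R}*/~_T` is
left-cancellative: for all words `A, X, Y` over `{L,R}`, if `AX ~_T AY` then `X ~_T Y`. -/
theorem sternCon_left_cancellative (T : Set ℕ) (hT : ∀ n ∈ T, 2 ≤ n)
    (A X Y : FreeMonoid Bool) (h : sternCon T (A * X) (A * Y)) : sternCon T X Y := by
  have hred : reduceAction T X 1 = reduceAction T Y 1 := by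
    refine reduceAction_injective hT A ?_
    rw [← reduceAction_mul, ← reduceAction_mul, reduceAction_eq_of_sternCon hT h]
  refine (sternCon T).trans (sternCon_reduceAction hT X) ?_
  rw [hred]
  exact (sternCon T).symm (sternCon_reduceAction hT Y)
end

section
/- For every subset T ⊆ {2, 3, 4, …}, the quotient monoid M_T = {L,R}*/~_T, partially ordered by left divisibility (X ≤ Y iff Y = XZ for some Z ∈ M_T) and ranked by the word-length function ℓ, is an upho poset. -/
open FreeMonoid

/-- The list of letters of `(LR)^n LL y`. -/
def altCons : ℕ → List Bool → List Bool
  | 0, y => false :: false :: y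
  | n + 1, y => false :: true :: altCons n y

/-- The list of letters of `R L^k RL y`. -/
def blockCons (k : ℕ) (y : List Bool) : List Bool :=
  true :: (List.replicate k false ++ true :: false :: y)

theorem altCons_inj {m n : ℕ} {x y : List Bool} (h : altCons m x = altCons n y) :
    m = n ∧ x = y := by
  induction m generalizing n with
  | zero => cases n <;> simp_all [altCons]
  | succ m ih =>
    cases n with
    | zero => simp [altCons] at h
    | succ n =>
      simp only [altCons, List.cons.injEq, true_and] at h
      simpa using ih h

theorem altCons_ne_true_cons (n : ℕ) (x y : List Bool) : altCons n x ≠ true :: y := by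
  cases n <;> simp [altCons]

theorem blockCons_inj {k l : ℕ} {x y : List Bool} (h : blockCons k x = blockCons l y) :
    k = l ∧ x = y := by
  induction k generalizing l with
  | zero => cases l <;> simp_all [blockCons, List.replicate_succ]
  | succ k ih =>
    cases l with
    | zero => simp [blockCons, List.replicate_succ] at h
    | succ l =>
      have := @ih l (by simpa [blockCons, List.replicate_succ] using h)
      simpa using this

open Classical in
/-- Left multiplication by `R` on normal forms for the rewriting rules `v_n → w_n`, `n ∈ T`. -/
noncomputable def pushR (T : Set ℕ) (x : List Bool) : List Bool :=
  if h : ∃ p : ℕ × List Bool, p.1 ∈ T ∧ x = blockCons (2 * p.1 - 2) p.2 then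
    altCons h.choose.1 h.choose.2
  else true :: x

theorem pushR_false_cons (T : Set ℕ) (x : List Bool) :
    pushR T (false :: x) = true :: false :: x := by
  simp [pushR, blockCons]

theorem pushR_cases (T : Set ℕ) (x : List Bool) :
    (∃ n ∈ T, ∃ y, x = blockCons (2 * n - 2) y ∧ pushR T x = altCons n y) ∨
      pushR T x = true :: x := by
  by_cases h : ∃ p : ℕ × List Bool, p.1 ∈ T ∧ x = blockCons (2 * p.1 - 2) p.2
  · exact Or.inl ⟨_, h.choose_spec.1, _, h.choose_spec.2, by rw [pushR, dif_pos h]⟩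
  · exact Or.inr (by rw [pushR, dif_neg h])

theorem pushR_blockCons {T : Set ℕ} (hT : ∀ n ∈ T, 2 ≤ n) {n : ℕ} (hn : n ∈ T)
    (y : List Bool) : pushR T (blockCons (2 * n - 2) y) = altCons n y := by
  have h : ∃ p : ℕ × List Bool, p.1 ∈ T ∧
      blockCons (2 * n - 2) y = blockCons (2 * p.1 - 2) p.2 := ⟨(n, y), hn, rfl⟩
  rw [pushR, dif_pos h]
  obtain ⟨hm, he⟩ := h.choose_spec
  obtain ⟨h₁, h₂⟩ := blockCons_inj he
  have h2n := hT _ hn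
  have h2m := hT _ hm
  rw [← h₂, show h.choose.1 = n by omega]

theorem pushR_injective (T : Set ℕ) : Function.Injective (pushR T) := by
  intro x y h
  rcases pushR_cases T x with ⟨n, -, x', rfl, hx⟩ | hx <;>
  rcases pushR_cases T y with ⟨m, -, y', rfl, hy⟩ | hy <;> rw [hx, hy] at h
  · obtain ⟨rfl, rfl⟩ := altCons_inj h
    rfl
  · exact absurd h (altCons_ne_true_cons _ _ _)
  · exact absurd h.symm (altCons_ne_true_cons _ _ _)
  · simpa using h

/-- The left action of `{L, R}*` on words in which `L` is prepended and `R` acts by `pushR`. -/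
noncomputable def normalAction (T : Set ℕ) : FreeMonoid Bool →* Function.End (List Bool) :=
  FreeMonoid.lift fun b => if b then pushR T else List.cons false

theorem normalAction_Lw (T : Set ℕ) (x : List Bool) :
    normalAction T Lw x = false :: x := by
  simp [normalAction, Lw]

theorem normalAction_Rw (T : Set ℕ) (x : List Bool) : normalAction T Rw x = pushR T x := by
  simp [normalAction, Rw]

theorem normalAction_mul (T : Set ℕ) (u v : FreeMonoid Bool) (x : List Bool) :
    normalAction T (u * v) x = normalAction T u (normalAction T v x) := by
  rw [map_mul]; rfl

theorem normalAction_injective (T : Set ℕ) (u : FreeMonoid Bool) :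
    Function.Injective (normalAction T u) := by
  induction u using FreeMonoid.recOn with
  | one => rw [map_one]; exact Function.injective_id
  | of_mul b u ih =>
    intro x y h
    rw [normalAction_mul, normalAction_mul] at h
    refine ih ?_
    cases b
    · change normalAction T Lw _ = normalAction T Lw _ at h
      simpa [normalAction_Lw] using h
    · change normalAction T Rw _ = normalAction T Rw _ at h
      rw [normalAction_Rw, normalAction_Rw] at h
      exact pushR_injective T h

theorem normalAction_wWord (T : Set ℕ) (n : ℕ) (x : List Bool) :
    normalAction T (wWord n) x = altCons n x := by
  induction n with
  | zero => simp [wWord, altCons, normalAction_mul, normalAction_Lw]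
  | succ n ih =>
    have h : wWord (n + 1) = Lw * (Rw * wWord n) := by simp only [wWord, pow_succ', mul_assoc]
    rw [h, normalAction_mul, normalAction_mul, ih, normalAction_Lw, normalAction_Rw]
    cases n <;> simp [altCons, pushR_false_cons]

theorem normalAction_Lw_pow (T : Set ℕ) (k : ℕ) (x : List Bool) :
    normalAction T (Lw ^ k) x = List.replicate k false ++ x := by
  induction k with
  | zero => rw [pow_zero, map_one]; rfl
  | succ k ih =>
    rw [pow_succ', normalAction_mul, ih, normalAction_Lw]
    rfl

theorem normalAction_vWord {T : Set ℕ} (hT : ∀ n ∈ T, 2 ≤ n) {n : ℕ} (hn : n ∈ T)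
    (x : List Bool) : normalAction T (vWord n) x = altCons n x := by
  obtain ⟨k, hk⟩ : ∃ k, 2 * n - 2 = k + 1 := ⟨2 * n - 3, by have := hT n hn; omega⟩
  simp only [vWord, normalAction_mul, normalAction_Lw, normalAction_Rw, normalAction_Lw_pow,
    pushR_false_cons]
  rw [← pushR_blockCons hT hn, blockCons, hk, List.replicate_succ, List.cons_append,
    pushR_false_cons]

theorem sternCon_le_ker_normalAction {T : Set ℕ} (hT : ∀ n ∈ T, 2 ≤ n) :
    sternCon T ≤ Con.ker (normalAction T) := by
  refine Con.conGen_le.2 ?_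
  rintro _ _ ⟨n, hn, rfl, rfl⟩
  rw [Con.ker_rel]
  funext x
  rw [normalAction_wWord, normalAction_vWord hT hn]

theorem ofList_altCons (n : ℕ) (y : List Bool) :
    ofList (altCons n y) = wWord n * ofList y := by
  induction n with
  | zero => rfl
  | succ n ih =>
    have h : wWord (n + 1) = Lw * (Rw * wWord n) := by simp only [wWord, pow_succ', mul_assoc]
    rw [h, mul_assoc, mul_assoc, ← ih]
    rfl

theorem ofList_replicate_append (k : ℕ) (y : List Bool) :
    ofList (List.replicate k false ++ y) = Lw ^ k * ofList y := by
  induction k with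
  | zero => rfl
  | succ k ih =>
    rw [pow_succ', mul_assoc, ← ih]
    rfl

theorem Rw_mul_ofList_blockCons (n : ℕ) (y : List Bool) :
    Rw * ofList (blockCons (2 * n - 2) y) = vWord n * ofList y := by
  have h : ofList (blockCons (2 * n - 2) y) =
      Rw * ofList (List.replicate (2 * n - 2) false ++ true :: false :: y) := rfl
  rw [h, ofList_replicate_append]
  simp only [vWord, mul_assoc]
  rfl

theorem sternCon_pushR (T : Set ℕ) (x : List Bool) :
    sternCon T (ofList (pushR T x)) (Rw * ofList x) := by
  rcases pushR_cases T x with ⟨n, hn, y, rfl, h⟩ | h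
  · rw [h, ofList_altCons, Rw_mul_ofList_blockCons]
    exact (sternCon T).mul (ConGen.Rel.of _ _ ⟨n, hn, rfl, rfl⟩) ((sternCon T).refl _)
  · rw [h]
    exact (sternCon T).refl _

theorem sternCon_normalAction_nil (T : Set ℕ) (u : FreeMonoid Bool) :
    sternCon T (ofList (normalAction T u [])) u := by
  induction u using FreeMonoid.recOn with
  | one => rw [map_one]; exact (sternCon T).refl _
  | of_mul b u ih =>
    rw [normalAction_mul]
    cases b
    · change sternCon T (ofList (normalAction T Lw _)) (Lw * u)
      rw [normalAction_Lw]
      exact (sternCon T).mul ((sternCon T).refl Lw) ih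
    · change sternCon T (ofList (normalAction T Rw _)) (Rw * u)
      rw [normalAction_Rw]
      exact (sternCon T).trans (sternCon_pushR T _) ((sternCon T).mul ((sternCon T).refl Rw) ih)

theorem sternCon_mul_left_cancel {T : Set ℕ} (hT : ∀ n ∈ T, 2 ≤ n) {u v w : FreeMonoid Bool}
    (h : sternCon T (u * v) (u * w)) : sternCon T v w := by
  have h' : normalAction T (u * v) = normalAction T (u * w) :=
    (Con.ker_rel _).1 (sternCon_le_ker_normalAction hT h)
  have hnil := congrFun h' []
  rw [normalAction_mul, normalAction_mul] at hnil
  have e := normalAction_injective T u hnil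
  have hv := sternCon_normalAction_nil T v
  rw [e] at hv
  exact (sternCon T).trans ((sternCon T).symm hv) (sternCon_normalAction_nil T w)

theorem sternCon_quotient_mul_left_cancel {T : Set ℕ} (hT : ∀ n ∈ T, 2 ≤ n)
    {s x y : (sternCon T).Quotient} (h : s * x = s * y) : x = y := by
  induction s using Con.induction_on with | H u => ?_
  induction x using Con.induction_on with | H v => ?_
  induction y using Con.induction_on with | H w => ?_
  rw [← Con.coe_mul, ← Con.coe_mul, Con.eq] at h
  exact (Con.eq _).2 (sternCon_mul_left_cancel hT h)

theorem length_Lw_pow (k : ℕ) : (Lw ^ k).length = k := by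
  induction k with
  | zero => rfl
  | succ k ih => rw [pow_succ, length_mul, ih]; rfl

theorem length_wWord (n : ℕ) : (wWord n).length = 2 * n + 2 := by
  induction n with
  | zero => rfl
  | succ n ih =>
    have h : wWord (n + 1) = Lw * (Rw * wWord n) := by simp only [wWord, pow_succ', mul_assoc]
    rw [h, length_mul, length_mul, ih, Lw, Rw, length_of, length_of]
    ring

theorem length_vWord {n : ℕ} (hn : 1 ≤ n) : (vWord n).length = 2 * n + 2 := by
  simp only [vWord, length_mul, length_Lw_pow]
  simp only [Lw, Rw, length_of]
  omega

theorem length_eq_of_sternCon {T : Set ℕ} (hT : ∀ n ∈ T, 2 ≤ n) {u v : FreeMonoid Bool}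
    (h : sternCon T u v) : u.length = v.length := by
  induction h with
  | of _ _ h =>
    obtain ⟨n, hn, rfl, rfl⟩ := h
    rw [length_wWord, length_vWord (by have := hT n hn; omega)]
  | refl => rfl
  | symm _ ih => exact ih.symm
  | trans _ _ ih₁ ih₂ => exact ih₁.trans ih₂
  | mul _ _ ih₁ ih₂ => rw [length_mul, length_mul, ih₁, ih₂]

/-- The word-length function on `M_T`. -/
def sternLength {T : Set ℕ} (hT : ∀ n ∈ T, 2 ≤ n) (x : (sternCon T).Quotient) : ℕ :=
  Con.liftOn x FreeMonoid.length fun _ _ h => length_eq_of_sternCon hT h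

theorem sternLength_mul {T : Set ℕ} (hT : ∀ n ∈ T, 2 ≤ n) (x y : (sternCon T).Quotient) :
    sternLength hT (x * y) = sternLength hT x + sternLength hT y := by
  induction x using Con.induction_on with | H u => ?_
  induction y using Con.induction_on with | H v => ?_
  exact length_mul u v

theorem eq_one_of_sternLength_eq_zero {T : Set ℕ} (hT : ∀ n ∈ T, 2 ≤ n)
    {x : (sternCon T).Quotient} (h : sternLength hT x = 0) : x = 1 := by
  induction x using Con.induction_on with | H u => ?_
  have hu : u = 1 := length_eq_zero.1 h
  rw [hu]
  rfl

/-- Left divisibility on `M_T`. -/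
abbrev sternOrder {T : Set ℕ} (hT : ∀ n ∈ T, 2 ≤ n) : PartialOrder (sternCon T).Quotient where
  le x y := ∃ z, y = x * z
  le_refl x := ⟨1, (mul_one x).symm⟩
  le_trans := by
    rintro x _ _ ⟨a, rfl⟩ ⟨b, rfl⟩
    exact ⟨a * b, mul_assoc x a b⟩
  le_antisymm := by
    rintro x _ ⟨a, rfl⟩ ⟨b, h⟩
    have hl := congrArg (sternLength hT) h
    simp only [sternLength_mul] at hl
    rw [eq_one_of_sternLength_eq_zero hT (x := a) (by omega), mul_one]

/-- For every subset `T ⊆ {2, 3, 4, …}`, the quotient monoid `M_T = {L,R}*/~_T`,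
partially ordered by left divisibility (`X ≤ Y` iff `Y = XZ` for some `Z ∈ M_T`) and
ranked by the word-length function `ℓ` (which descends from word length on `{L,R}*`),
is an upho poset. -/
theorem sternCon_quotient_upho (T : Set ℕ) (hT : ∀ n ∈ T, 2 ≤ n) :
    ∃ ℓ : (sternCon T).Quotient → ℕ,
      (∀ w : FreeMonoid Bool, ℓ (w : (sternCon T).Quotient) = w.length) ∧
      ∃ inst : PartialOrder (sternCon T).Quotient,
        (∀ x y : (sternCon T).Quotient, inst.le x y ↔ ∃ z, y = x * z) ∧
        @IsUpho (sternCon T).Quotient inst ℓ := by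
  refine ⟨sternLength hT, fun _ => rfl, sternOrder hT, fun _ _ => Iff.rfl, ?_⟩
  let := sternOrder hT
  refine ⟨⟨fun x hx => ?_, fun x y hxy => ?_⟩, fun n => ?_, fun s => ?_⟩
  · have h1 : (1 : (sternCon T).Quotient) ≤ x := ⟨x, (one_mul x).symm⟩
    rw [← h1.eq_of_not_lt (hx 1)]
    rfl
  · obtain ⟨z, rfl⟩ := hxy.le
    induction z using Con.induction_on with | H u => ?_
    cases u using FreeMonoid.casesOn with
    | one => exact absurd hxy.lt (by rw [Con.coe_one, mul_one]; exact lt_irrefl x)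
    | of_mul b u =>
      set a : (sternCon T).Quotient := ((FreeMonoid.of b : FreeMonoid Bool) : (sternCon T).Quotient)
      have hla : sternLength hT a = 1 := rfl
      have hlt : x < x * a := by
        refine lt_of_le_of_ne ⟨a, rfl⟩ fun h => ?_
        have := congrArg (sternLength hT) h
        rw [sternLength_mul] at this
        omega
      have hle : x * a ≤ x * ((FreeMonoid.of b * u : FreeMonoid Bool) : (sternCon T).Quotient) :=
        ⟨u, by rw [Con.coe_mul, mul_assoc]⟩
      rw [← hle.eq_of_not_lt (hxy.2 hlt), sternLength_mul, hla]
  · refine ((List.finite_length_eq Bool n).image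
      fun l => ((ofList l : FreeMonoid Bool) : (sternCon T).Quotient)).subset fun x hx => ?_
    induction x using Con.induction_on with | H u => ?_
    exact ⟨toList u, hx, rfl⟩
  · let f : (sternCon T).Quotient → {t // s ≤ t} := fun x => ⟨s * x, x, rfl⟩
    have hf : Function.Bijective f :=
      ⟨fun x y h => sternCon_quotient_mul_left_cancel hT (congrArg Subtype.val h),
        fun ⟨_, x, hx⟩ => ⟨x, Subtype.ext hx.symm⟩⟩
    refine ⟨OrderIso.symm ⟨Equiv.ofBijective f hf, fun {x y} => ?_⟩⟩
    constructor
    · rintro ⟨z, hz⟩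
      exact ⟨z, sternCon_quotient_mul_left_cancel hT (hz.trans (mul_assoc s x z))⟩
    · rintro ⟨z, rfl⟩
      exact ⟨z, (mul_assoc s x z).symm⟩
end

section
/- For every integer n ≥ 2 and every subset T ⊆ {2, 3, 4, …} with n ∉ T, the words w_n = (LR)^n LL and v_n = RR L^{2n−2} RL are not ~_T-equivalent; that is, the relation (w_n, v_n) is not implied by the relations {(w_m, v_m) : m ∈ T}. -/
/-- `v_n` as a list of letters. -/
theorem toList_vWord (n : ℕ) : (vWord n).toList =
    true :: true :: (List.replicate (2 * n - 2) false ++ [true, false]) := by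
  have h (k : ℕ) : (FreeMonoid.of false ^ k).toList = List.replicate k false := by
    induction k with
    | zero => rfl
    | succ k ih => rw [pow_succ', FreeMonoid.toList_mul, ih]; rfl
  simp [vWord, FreeMonoid.toList_mul, h, Rw, Lw, FreeMonoid.toList_of]

/-- For `n ≥ 2` the word `w_n` begins with `LRLR`. -/
theorem exists_toList_wWord {n : ℕ} (hn : 2 ≤ n) :
    ∃ c, (wWord n).toList = false :: true :: false :: true :: c := by
  obtain ⟨k, rfl⟩ := Nat.exists_eq_add_of_le' hn
  refine ⟨((Lw * Rw) ^ k * (Lw * Lw)).toList, ?_⟩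
  simp [wWord, pow_succ', FreeMonoid.toList_mul, Rw, Lw, FreeMonoid.toList_of]

/-- A word with two letters `R` is not a factor of `L^k RL`. -/
theorem append_ne_replicate_append (a c : List Bool) (k : ℕ) (hc : 2 ≤ c.count true) :
    a ++ c ≠ List.replicate k false ++ [true, false] := by
  intro h
  have := congrArg (List.count true) h
  simp [List.count_append, List.count_replicate] at this
  omega

/-- The exponent of an initial block of letters `L` followed by `R` is determined by the word. -/
theorem replicate_append_cons_inj {k l : ℕ} {b c : List Bool}
    (h : List.replicate k false ++ true :: b = List.replicate l false ++ true :: c) : k = l := by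
  induction k generalizing l with
  | zero => cases l <;> simp_all [List.replicate_succ]
  | succ k ih =>
    cases l with
    | zero => simp [List.replicate_succ] at h
    | succ l =>
      simp only [List.replicate_succ, List.cons_append, List.cons.injEq, true_and] at h
      rw [ih h]

/-- No word `w_m` with `m ≥ 2` is a factor of a word `v_n`. -/
theorem mul_wWord_mul_ne_vWord {m : ℕ} (n : ℕ) (hm : 2 ≤ m) (a b : FreeMonoid Bool) :
    a * wWord m * b ≠ vWord n := by
  intro h
  obtain ⟨c, hc⟩ := exists_toList_wWord hm
  replace h := congrArg FreeMonoid.toList h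
  rw [FreeMonoid.toList_mul, FreeMonoid.toList_mul, hc, toList_vWord] at h
  generalize a.toList = s at h
  rcases s with _ | ⟨x, _ | ⟨y, s⟩⟩
  · simp at h
  · simp at h
  · simp only [List.cons_append, List.append_assoc, List.cons.injEq] at h
    exact append_ne_replicate_append _ _ _ (by simp) h.2.2

/-- If `v_m` is a factor of `v_n` and `m, n ≥ 2`, then `m = n`. -/
theorem eq_of_mul_vWord_mul_eq {m n : ℕ} (hm : 2 ≤ m) (hn : 2 ≤ n) {a b : FreeMonoid Bool}
    (h : a * vWord m * b = vWord n) : m = n := by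
  replace h := congrArg FreeMonoid.toList h
  rw [FreeMonoid.toList_mul, FreeMonoid.toList_mul, toList_vWord, toList_vWord] at h
  generalize a.toList = s at h
  rcases s with _ | ⟨x, _ | ⟨y, s⟩⟩
  · simp only [List.nil_append, List.cons_append, List.append_assoc, List.cons.injEq,
      true_and] at h
    have := replicate_append_cons_inj h
    omega
  · obtain ⟨k, hk⟩ : ∃ k, 2 * n - 2 = k + 1 := ⟨2 * n - 3, by omega⟩
    simp [hk, List.replicate_succ] at h
  · simp only [List.cons_append, List.append_assoc, List.cons.injEq] at h
    exact (append_ne_replicate_append _ _ _ (by simp) h.2.2).elim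

/-- The syntactic congruence of the one-word language `{x}`. -/
def syntacticCon {M : Type*} [Monoid M] (x : M) : Con M where
  r u v := ∀ a b, a * u * b = x ↔ a * v * b = x
  iseqv := ⟨fun _ _ _ => Iff.rfl, fun h a b => (h a b).symm,
    fun h h' a b => (h a b).trans (h' a b)⟩
  mul' {u v u' v'} h h' a b := by
    have h₁ := h a (u' * b)
    have h₂ := h' (a * v) b
    simp only [mul_assoc] at h₁ h₂ ⊢
    exact h₁.trans h₂

/-- For every integer `n ≥ 2` and every subset `T ⊆ {2, 3, 4, …}` with `n ∉ T`, the words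
`w_n = (LR)^n LL` and `v_n = RR L^(2n−2) RL` are not `~_T`-equivalent; that is, the
relation `(w_n, v_n)` is not implied by the relations `{(w_m, v_m) : m ∈ T}`. -/
theorem sternRel_independent (n : ℕ) (hn : 2 ≤ n) (T : Set ℕ) (hT : ∀ m ∈ T, 2 ≤ m)
    (hnT : n ∉ T) : ¬ sternCon T (wWord n) (vWord n) := by
  intro h
  have hle : sternCon T ≤ syntacticCon (vWord n) := by
    refine Con.conGen_le.2 ?_
    rintro _ _ ⟨m, hm, rfl, rfl⟩ a b
    refine iff_of_false (mul_wWord_mul_ne_vWord n (hT m hm) a b) fun hv => hnT ?_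
    rwa [← eq_of_mul_vWord_mul_eq (hT m hm) hn hv]
  exact mul_wWord_mul_ne_vWord n hn 1 1 ((hle h 1 1).2 (by simp))
end
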